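/- For all γ > 0 there exists n₀ = n₀(γ) ∈ ℕ such that for all n ≥ n₀ with n divisible by 3 the following holds: if H is a 3-graph on n vertices with minimum vertex degree δ₁(H) ≥ (5/9 + γ)·C(n,2), then H contains a perfect matching. -/

import Mathlib

open Finset
open scoped Classical

noncomputable section

/-- The degree of a vertex `v` in a `3`-graph `H` on `Fin n`:
the number of edges containing `v`. -/
def deg {n : ℕ} (H : Finset (Finset (Fin n))) (v : Fin n) : ℕ :=
  (H.filter fun e => v ∈ e).card

/-- `H` is a `3`-graph: every edge has exactly three vertices. -/
def Is3Graph (n : ℕ) (H : Finset (Finset (Fin n))) : Prop :=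
  ∀ e ∈ H, e.card = 3

/-- `M` is a matching in `H`: a set of pairwise disjoint edges of `H`. -/
def IsMatching {n : ℕ} (H M : Finset (Finset (Fin n))) : Prop :=
  M ⊆ H ∧ ∀ e ∈ M, ∀ f ∈ M, e ≠ f → Disjoint e f

/-- The set of vertices covered by a collection `M` of edges. -/
def cover {n : ℕ} (M : Finset (Finset (Fin n))) : Finset (Fin n) :=
  M.biUnion id

/-- `M` is a perfect matching in `H`: a matching covering all vertices. -/
def IsPerfectMatching {n : ℕ} (H M : Finset (Finset (Fin n))) : Prop :=
  IsMatching H M ∧ cover M = univ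

section Tiling

variable {α : Type*} [DecidableEq α]

/-- `M` is a partition of `S` into members of the family `F`. -/
def IsTiling (F : Set (Finset α)) (M : Finset (Finset α)) (S : Finset α) : Prop :=
  (∀ e ∈ M, e ∈ F) ∧ (M : Set (Finset α)).PairwiseDisjoint id ∧ M.biUnion id = S

/-- `S` can be partitioned into members of the family `F`. -/
def Tileable (F : Set (Finset α)) (S : Finset α) : Prop :=
  ∃ M, IsTiling F M S

variable {F : Set (Finset α)} {M N : Finset (Finset α)} {S T : Finset α}

lemma IsTiling.subset_of_mem (h : IsTiling F M S) {e : Finset α} (he : e ∈ M) : e ⊆ S := by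
  rw [← h.2.2]
  exact Finset.subset_biUnion_of_mem id he

lemma IsTiling.sum_eq {β : Type*} [AddCommMonoid β] (h : IsTiling F M S) (f : α → β) :
    ∑ x ∈ S, f x = ∑ e ∈ M, ∑ x ∈ e, f x := by
  rw [← h.2.2, Finset.sum_biUnion h.2.1]
  rfl

lemma IsTiling.mono (h : IsTiling F M S) (hN : N ⊆ M) : IsTiling F N (N.biUnion id) :=
  ⟨fun e he => h.1 e (hN he), h.2.1.subset (by exact_mod_cast hN), rfl⟩

lemma IsTiling.card_eq (h : IsTiling F M S) {r : ℕ} (hF : ∀ e ∈ F, e.card = r) :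
    S.card = r * M.card := by
  rw [Finset.card_eq_sum_ones, h.sum_eq, Finset.sum_congr rfl
    (fun e he => (Finset.card_eq_sum_ones e).symm.trans (hF e (h.1 e he))), Finset.sum_const,
    smul_eq_mul, mul_comm]

lemma IsTiling.biUnion_sdiff (h : IsTiling F M S) (hN : N ⊆ M) :
    (M \ N).biUnion id = S \ N.biUnion id := by
  ext x
  simp only [Finset.mem_biUnion, Finset.mem_sdiff, id, ← h.2.2]
  constructor
  · rintro ⟨e, ⟨he, heN⟩, hx⟩
    refine ⟨⟨e, he, hx⟩, ?_⟩
    rintro ⟨f, hf, hxf⟩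
    have hef : e ≠ f := fun h => heN (h ▸ hf)
    exact Finset.disjoint_left.1 (h.2.1 he (hN hf) hef) hx hxf
  · rintro ⟨⟨e, he, hx⟩, hn⟩
    exact ⟨e, ⟨he, fun heN => hn ⟨e, heN, hx⟩⟩, hx⟩

lemma IsTiling.tileable_sdiff (h : IsTiling F M S) (hN : N ⊆ M) :
    Tileable F (S \ N.biUnion id) := by
  rw [← h.biUnion_sdiff hN]
  exact ⟨_, h.mono Finset.sdiff_subset⟩

lemma tileable_empty (F : Set (Finset α)) : Tileable F ∅ :=
  ⟨∅, by simp [IsTiling]⟩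

lemma tileable_of_mem (h : S ∈ F) : Tileable F S :=
  ⟨{S}, by simp [IsTiling, h]⟩

lemma Tileable.union (hS : Tileable F S) (hT : Tileable F T) (hd : Disjoint S T) :
    Tileable F (S ∪ T) := by
  obtain ⟨M, hM⟩ := hS
  obtain ⟨N, hN⟩ := hT
  refine ⟨M ∪ N, ?_, ?_, ?_⟩
  · intro e he
    rcases Finset.mem_union.1 he with he | he
    exacts [hM.1 e he, hN.1 e he]
  · rw [Finset.coe_union, Set.pairwiseDisjoint_union]
    exact ⟨hM.2.1, hN.2.1, fun e he f hf _ =>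
      hd.mono (hM.subset_of_mem he) (hN.subset_of_mem hf)⟩
  · rw [Finset.union_biUnion, hM.2.2, hN.2.2]

lemma tileable_of_card_eq {r : ℕ} (k : ℕ) :
    ∀ S : Finset α, S.card = r * k → Tileable {e | e.card = r} S := by
  induction k with
  | zero =>
    intro S hS
    obtain rfl : S = ∅ := Finset.card_eq_zero.1 (by simpa using hS)
    exact tileable_empty _
  | succ k ih =>
    intro S hS
    obtain ⟨T, hTS, hT⟩ := Finset.exists_subset_card_eq (n := r) (s := S)
      (by rw [hS]; exact Nat.le_mul_of_pos_right _ k.succ_pos)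
    have h1 : (S \ T).card = r * k := by
      rw [Finset.card_sdiff_of_subset hTS, hS, hT, Nat.mul_succ, Nat.add_sub_cancel]
    have h2 := (ih _ h1).union (tileable_of_mem (F := {e | e.card = r}) hT)
      Finset.sdiff_disjoint
    rwa [Finset.sdiff_union_of_subset hTS] at h2

/-- Extending the members of a tiling by distinct new points. -/
lemma tileable_of_insert {G : Set (Finset α)} {Y : Finset α}
    (hG : ∀ y ∈ Y, ∀ e ∈ G, insert y e ∈ F) :
    ∀ (M : Finset (Finset α)) (Z : Finset α), IsTiling G M (M.biUnion id) → Z ⊆ Y →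
      Disjoint Z (M.biUnion id) → Z.card = M.card → Tileable F (M.biUnion id ∪ Z) := by
  intro M
  induction M using Finset.induction_on with
  | empty =>
    intro Z _ _ _ hZ
    obtain rfl : Z = ∅ := Finset.card_eq_zero.1 (by simpa using hZ)
    simpa using tileable_empty F
  | insert e M he ih =>
    intro Z hM hZY hd hZ
    rw [Finset.card_insert_of_notMem he] at hZ
    obtain ⟨z, hz⟩ := Finset.card_pos.1 (by omega : 0 < Z.card)
    have hbi : (insert e M).biUnion id = e ∪ M.biUnion id := by simp
    rw [hbi, Finset.disjoint_union_right] at hd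
    have hdM : Disjoint e (M.biUnion id) := by
      rw [Finset.disjoint_biUnion_right]
      intro f hf
      exact hM.2.1 (by simp) (by simp [hf]) (fun h => he (h ▸ hf))
    have h1 := ih (Z.erase z) (hM.mono (Finset.subset_insert _ _))
      ((Finset.erase_subset _ _).trans hZY)
      (hd.2.mono_left (Finset.erase_subset _ _)) (by rw [Finset.card_erase_of_mem hz]; omega)
    have h2 := (tileable_of_mem (hG z (hZY hz) e (hM.1 e (by simp)))).union h1 (by
      rw [Finset.disjoint_insert_left, Finset.disjoint_union_right]
      refine ⟨?_, hdM, hd.1.symm.mono_right (Finset.erase_subset _ _)⟩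
      simp only [Finset.mem_union, Finset.mem_erase, not_or]
      exact ⟨Finset.disjoint_left.1 hd.2 hz, by simp⟩)
    convert h2 using 1
    rw [hbi]
    nth_rewrite 1 [← Finset.insert_erase hz]
    ext x
    simp only [Finset.mem_union, Finset.mem_insert]
    tauto

end Tiling

section GraphMatching

variable {α : Type*} [DecidableEq α]

/-- The edges of the graph with adjacency relation `adj`. -/
def pairEdges (adj : α → α → Prop) : Set (Finset α) :=
  {e | ∃ a b, adj a b ∧ e = {a, b}}

lemma add_add_le_five_mul_sq_add {i k s t u v : ℕ} (hi : i + 2 * k = 3 * s) (hk : k ≤ s) (ht : t ≤ k)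
    (hu : u + t ^ 2 ≤ 4 * k ^ 2) (hv : v ≤ t * i + 2 * k) :
    u + v + (v + 0) ≤ 5 * s ^ 2 + 4 * s := by
  obtain ⟨a, rfl⟩ := Nat.exists_eq_add_of_le ht
  obtain ⟨b, rfl⟩ := Nat.exists_eq_add_of_le hk
  obtain rfl : i = t + a + 3 * b := by omega
  nlinarith [Nat.zero_le (t * b), Nat.zero_le (a * b), sq_nonneg a, sq_nonneg b]

/-- An asymptotic form of the Erdős-Gallai bound: a graph on `3 s` vertices without a matching of
size `s + 1` has at most `(5 s ^ 2 + 4 s) / 2` edges. -/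
theorem card_adj_le_of_matching_le {adj : α → α → Prop} (hsymm : ∀ a b, adj a b → adj b a)
    (hirr : ∀ a, ¬ adj a a) {W : Finset α} {s : ℕ} (hW : W.card = 3 * s)
    (hno : ∀ S ⊆ W, Tileable (pairEdges adj) S → S.card ≤ 2 * s) :
    ((W ×ˢ W).filter fun p => adj p.1 p.2).card ≤ 5 * s ^ 2 + 4 * s := by
  rcases isEmpty_or_nonempty α with hα | hα
  · simp [Finset.eq_empty_of_isEmpty W]
  have hcard : ∀ e ∈ pairEdges adj, e.card = 2 := by
    rintro e ⟨a, b, hab, rfl⟩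
    exact Finset.card_pair (fun h => hirr a (by rwa [← h] at hab))
  have hedge : ∀ {a b}, adj a b → Tileable (pairEdges adj) {a, b} :=
    fun {a b} h => tileable_of_mem ⟨a, b, h, rfl⟩
  have hcp : ∀ {a b}, adj a b → ({a, b} : Finset α).card = 2 := fun {a b} h =>
    hcard _ ⟨a, b, h, rfl⟩
  obtain ⟨S, hS, hmax⟩ := Finset.exists_max_image
    (W.powerset.filter fun S => Tileable (pairEdges adj) S) Finset.card
    ⟨∅, by simp [tileable_empty]⟩
  simp only [Finset.mem_filter, Finset.mem_powerset] at hS hmax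
  obtain ⟨hSW, M, hM⟩ := hS
  have hSc := hM.card_eq hcard
  have hk : M.card ≤ s := by
    have := hno S hSW ⟨M, hM⟩
    omega
  -- the augmentation principle
  have haug : ∀ N ⊆ M, ∀ T ⊆ W, Tileable (pairEdges adj) T →
      Disjoint (S \ N.biUnion id) T → T.card ≤ 2 * N.card := by
    intro N hN T hT hTt hd
    have h1 := hmax ((S \ N.biUnion id) ∪ T)
      ⟨Finset.union_subset (Finset.sdiff_subset.trans hSW) hT,
        (hM.tileable_sdiff hN).union hTt hd⟩
    have h2 : (N.biUnion id).card = 2 * N.card := (hM.mono hN).card_eq hcard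
    have h3 : N.biUnion id ⊆ S := by
      rw [← hM.2.2]; exact Finset.biUnion_subset_biUnion_of_subset_left _ hN
    rw [Finset.card_union_of_disjoint hd, Finset.card_sdiff_of_subset h3] at h1
    have := Finset.card_le_card h3
    omega
  set I := W \ S with hI
  have hIW : I ⊆ W := Finset.sdiff_subset
  have hIc : I.card + 2 * M.card = 3 * s := by
    have := Finset.card_sdiff_add_card_eq_card hSW
    rw [← hI] at this
    omega
  have hIS : Disjoint S I := Finset.disjoint_sdiff
  let A : α → α → ℕ := fun x y => if adj x y then 1 else 0
  have hAs : ∀ x y, A x y = A y x := fun x y => by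
    simp only [A]; exact if_congr ⟨hsymm _ _, hsymm _ _⟩ rfl rfl
  have hA1 : ∀ x y, A x y ≤ 1 := fun x y => by simp only [A]; split_ifs <;> simp
  let d : α → ℕ := fun x => ∑ y ∈ I, A x y
  have hd_eq : ∀ x, d x = (I.filter fun y => adj x y).card := fun x => by
    simp [d, A]
  have hdI : ∀ x, d x ≤ I.card := fun x => by
    rw [hd_eq]; exact Finset.card_filter_le _ _
  have hII : ∀ x ∈ I, ∀ y ∈ I, A x y = 0 := by
    intro x hx y hy
    by_contra hne
    have hxy : adj x y := by
      by_contra h; simp [A, h] at hne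
    have := haug ∅ (Finset.empty_subset _) {x, y}
      (by intro z hz; rcases Finset.mem_insert.1 hz with rfl | hz
          · exact hIW hx
          · rw [Finset.mem_singleton.1 hz]; exact hIW hy) (hedge hxy) (by
        refine (hIS.mono_left Finset.sdiff_subset).mono_right ?_
        intro z hz; rcases Finset.mem_insert.1 hz with rfl | hz
        · exact hx
        · rw [Finset.mem_singleton.1 hz]; exact hy)
    rw [hcp hxy] at this
    simp at this
  have hor : ∀ e ∈ M, ∃ a b, adj a b ∧ e = {a, b} ∧ d b ≤ d a := by
    intro e he
    obtain ⟨a, b, hab, rfl⟩ := hM.1 e he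
    rcases le_total (d b) (d a) with h | h
    · exact ⟨a, b, hab, rfl, h⟩
    · exact ⟨b, a, hsymm _ _ hab, Finset.pair_comm _ _, h⟩
  choose! a b hab heq hdab using hor
  have haS : ∀ e ∈ M, a e ∈ S := fun e he =>
    hM.subset_of_mem he ((Finset.ext_iff.1 (heq e he) _).2 (by simp))
  have hbS : ∀ e ∈ M, b e ∈ S := fun e he =>
    hM.subset_of_mem he ((Finset.ext_iff.1 (heq e he) _).2 (by simp))
  have hsum : ∀ f : α → ℕ, ∑ x ∈ S, f x = ∑ e ∈ M, (f (a e) + f (b e)) := by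
    intro f
    rw [hM.sum_eq]
    refine Finset.sum_congr rfl fun e he => ?_
    nth_rewrite 1 [heq e he]
    exact Finset.sum_pair fun h => hirr (a e) (by have := hab e he; rwa [← h] at this)
  have hex : ∀ x y, 2 ≤ d x → ∃ z ∈ I, adj x z ∧ y ≠ z := by
    intro x y hx
    rw [hd_eq] at hx
    obtain ⟨z, hz, hzy⟩ := Finset.exists_mem_ne hx y
    rw [Finset.mem_filter] at hz
    exact ⟨z, hz.1, hz.2, hzy.symm⟩
  have hSI : ∀ {x y}, x ∈ S → y ∈ I → x ≠ y := fun hx hy h =>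
    Finset.disjoint_left.1 hIS hx (h ▸ hy)
  have hnoext : ∀ e ∈ M, ∀ x ∈ I, ∀ y ∈ I, x ≠ y → adj (a e) x → ¬ adj (b e) y := by
    intro e he x hx y hy hxy hax hby
    have hne : a e ≠ b e := fun h => hirr (a e) (by have := hab e he; rwa [← h] at this)
    have hd : Disjoint ({a e, x} : Finset α) {b e, y} := by
      have := hSI (haS e he) hy
      have := hSI (hbS e he) hx
      simp only [Finset.disjoint_insert_left, Finset.disjoint_singleton_left, Finset.mem_insert,
        Finset.mem_singleton]
      tauto
    have := haug {e} (by simpa using he) ({a e, x} ∪ {b e, y})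
      (by
        have := hSW (haS e he)
        have := hSW (hbS e he)
        have := hIW hx
        have := hIW hy
        simp only [Finset.union_subset_iff, Finset.insert_subset_iff,
          Finset.singleton_subset_iff]
        tauto)
      ((hedge hax).union (hedge hby) hd) (by
        rw [Finset.disjoint_left]
        intro z hz
        rw [Finset.singleton_biUnion, id, heq e he] at hz
        rw [Finset.mem_sdiff] at hz
        have := hSI hz.1 hx
        have := hSI hz.1 hy
        have := hz.2
        simp only [Finset.mem_union, Finset.mem_insert, Finset.mem_singleton] at *
        tauto)
    rw [Finset.card_union_of_disjoint hd, hcp hax, hcp hby] at this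
    simp at this
  have hnoswap : ∀ e ∈ M, ∀ e' ∈ M, 2 ≤ d (a e) → 2 ≤ d (a e') → ¬ adj (b e) (b e') := by
    intro e he e' he' hde hde' hbb
    have hee : e ≠ e' := by
      rintro rfl; exact hirr _ hbb
    obtain ⟨x, hx, hax, -⟩ := hex (a e) (a e) hde
    obtain ⟨y, hy, hay, hxy⟩ := hex (a e') x hde'
    have hne : a e ≠ b e := fun h => hirr (a e) (by have := hab e he; rwa [← h] at this)
    have hne' : a e' ≠ b e' := fun h => hirr (a e') (by have := hab e' he'; rwa [← h] at this)
    have hdee : Disjoint ({a e, b e} : Finset α) {a e', b e'} := by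
      rw [← heq e he, ← heq e' he']; exact hM.2.1 he he' hee
    have hd1 : Disjoint ({a e, x} : Finset α) {a e', y} := by
      have := hSI (haS e he) hy
      have := hSI (haS e' he') hx
      simp only [Finset.disjoint_insert_left, Finset.disjoint_singleton_left, Finset.mem_insert,
        Finset.mem_singleton] at *
      tauto
    have hd2 : Disjoint ({a e, x} ∪ {a e', y} : Finset α) {b e, b e'} := by
      have := hSI (hbS e he) hy
      have := hSI (hbS e' he') hx
      have := hSI (hbS e he) hx
      have := hSI (hbS e' he') hy
      simp only [Finset.disjoint_union_left, Finset.disjoint_insert_left,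
        Finset.disjoint_singleton_left, Finset.mem_insert,
        Finset.mem_singleton] at *
      simp only [eq_comm] at *
      tauto
    have := haug {e, e'} (by
        simp only [Finset.insert_subset_iff, Finset.singleton_subset_iff]; exact ⟨he, he'⟩)
      (({a e, x} ∪ {a e', y}) ∪ {b e, b e'})
      (by
        have := hSW (haS e he)
        have := hSW (hbS e he)
        have := hSW (haS e' he')
        have := hSW (hbS e' he')
        have := hIW hx
        have := hIW hy
        simp only [Finset.union_subset_iff, Finset.insert_subset_iff,
          Finset.singleton_subset_iff]
        tauto)
      (((hedge hax).union (hedge hay) hd1).union (hedge hbb) hd2) (by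
        rw [Finset.disjoint_left]
        intro z hz
        rw [Finset.biUnion_insert, Finset.singleton_biUnion, id, id, heq e he, heq e' he'] at hz
        rw [Finset.mem_sdiff] at hz
        have := hSI hz.1 hx
        have := hSI hz.1 hy
        have := hz.2
        simp only [Finset.mem_union, Finset.mem_insert, Finset.mem_singleton] at *
        tauto)
    rw [Finset.card_union_of_disjoint hd2, Finset.card_union_of_disjoint hd1, hcp hax, hcp hay,
      hcp hbb, Finset.card_pair hee] at this
    omega
  let h : Finset α → ℕ := fun e => if 2 ≤ d (a e) then 1 else 0
  have hlink : ∀ e ∈ M, d (a e) + d (b e) ≤ h e * I.card + 2 := by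
    intro e he
    by_cases hh : 2 ≤ d (a e)
    · have hb : d (b e) = 0 := by
        rw [hd_eq, Finset.card_eq_zero, Finset.filter_eq_empty_iff]
        intro y hy hby
        obtain ⟨z, hz, haz, hyz⟩ := hex _ y hh
        exact hnoext e he z hz y hy hyz.symm haz hby
      have := hdI (a e)
      simp only [h, if_pos hh]
      omega
    · have := hdab e he
      simp only [h, if_neg hh]
      omega
  have hcross : ∀ e ∈ M, ∀ e' ∈ M, (A (a e) (a e') + A (a e) (b e')) +
      (A (b e) (a e') + A (b e) (b e')) + h e * h e' ≤ 4 := by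
    intro e he e' he'
    have h1 := hA1 (a e) (a e')
    have h2 := hA1 (a e) (b e')
    have h3 := hA1 (b e) (a e')
    have h4 := hA1 (b e) (b e')
    by_cases hh : 2 ≤ d (a e) ∧ 2 ≤ d (a e')
    · have : A (b e) (b e') = 0 := if_neg (hnoswap e he e' he' hh.1 hh.2)
      simp only [h, if_pos hh.1, if_pos hh.2]
      omega
    · have : h e * h e' = 0 := by
        rcases not_and_or.1 hh with hh | hh <;> simp [h, hh]
      omega
  have htot : ((W ×ˢ W).filter fun p => adj p.1 p.2).card = ∑ x ∈ W, ∑ y ∈ W, A x y := by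
    rw [Finset.card_filter, Finset.sum_product]
  have hsplit : ∀ f : α → ℕ, ∑ x ∈ W, f x = ∑ x ∈ S, f x + ∑ x ∈ I, f x := fun f => by
    rw [add_comm]; exact (Finset.sum_sdiff hSW).symm
  have hSS : ∑ x ∈ S, ∑ y ∈ S, A x y + (∑ e ∈ M, h e) ^ 2 ≤ 4 * M.card ^ 2 := by
    have : ∑ e ∈ M, ∑ e' ∈ M, ((A (a e) (a e') + A (a e) (b e')) +
      (A (b e) (a e') + A (b e) (b e')) + h e * h e') ≤ ∑ e ∈ M, ∑ e' ∈ M, 4 :=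
      Finset.sum_le_sum fun e he => Finset.sum_le_sum fun e' he' => hcross e he e' he'
    rw [hsum, sq (∑ e ∈ M, h e), Finset.sum_mul_sum, ← Finset.sum_add_distrib]
    simp only [hsum]
    simp only [← Finset.sum_add_distrib]
    refine this.trans ?_
    simp only [Finset.sum_const, smul_eq_mul]
    nlinarith
  have hSI' : ∑ x ∈ S, ∑ y ∈ I, A x y ≤ (∑ e ∈ M, h e) * I.card + 2 * M.card := by
    change ∑ x ∈ S, d x ≤ _
    rw [hsum]
    refine (Finset.sum_le_sum hlink).trans ?_
    rw [Finset.sum_add_distrib, ← Finset.sum_mul, Finset.sum_const, smul_eq_mul, mul_comm 2]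
  have hIS' : ∑ x ∈ I, ∑ y ∈ S, A x y = ∑ x ∈ S, ∑ y ∈ I, A x y := by
    rw [Finset.sum_comm]
    exact Finset.sum_congr rfl fun x _ => Finset.sum_congr rfl fun y _ => hAs _ _
  have hII' : ∑ x ∈ I, ∑ y ∈ I, A x y = 0 :=
    Finset.sum_eq_zero fun x hx => Finset.sum_eq_zero fun y hy => hII x hx y hy
  have hh : ∑ e ∈ M, h e ≤ M.card := by
    rw [Finset.card_eq_sum_ones]
    refine Finset.sum_le_sum fun e _ => ?_
    simp only [h]; split_ifs <;> simp
  rw [htot, hsplit]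
  simp only [hsplit, Finset.sum_add_distrib]
  rw [hIS', hII']
  generalize ∑ x ∈ S, ∑ y ∈ S, A x y = u at *
  generalize ∑ x ∈ S, ∑ y ∈ I, A x y = v at *
  generalize ∑ e ∈ M, h e = t at *
  generalize M.card = k at *
  generalize I.card = i at *
  exact add_add_le_five_mul_sq_add hIc hk hh hSS hSI'

end GraphMatching

section AlmostPerfect

/-- Some `s`-subset has at least the average density of off-diagonal weights. -/
lemma exists_subset_sum_ge {ι : Type*} [DecidableEq ι] {w : ι → ι → ℝ} (hw : ∀ i, w i i = 0)
    {c : ℝ} {s : ℕ} (hs : 2 ≤ s) : ∀ (m : ℕ) (P : Finset ι), P.card = s + m →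
      c * (P.card * (P.card - 1)) ≤ ∑ i ∈ P, ∑ j ∈ P, w i j →
      ∃ Q ⊆ P, Q.card = s ∧ c * (s * (s - 1)) ≤ ∑ i ∈ Q, ∑ j ∈ Q, w i j := by
  intro m
  induction m with
  | zero => intro P hP h; exact ⟨P, subset_rfl, by simpa using hP, by simpa [hP] using h⟩
  | succ m ih =>
    intro P hP h
    have herase : ∀ k ∈ P, ∑ i ∈ P.erase k, ∑ j ∈ P.erase k, w i j =
        ∑ i ∈ P, ∑ j ∈ P, w i j - ∑ j ∈ P, w k j - ∑ i ∈ P, w i k := by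
      intro k hk
      have h1 : ∀ f : ι → ℝ, ∑ i ∈ P.erase k, f i = ∑ i ∈ P, f i - f k := fun f => by
        rw [← Finset.add_sum_erase P f hk]; ring
      simp only [h1, Finset.sum_sub_distrib, hw]
      ring
    have hsum : ∑ k ∈ P, ∑ i ∈ P.erase k, ∑ j ∈ P.erase k, w i j =
        ((P.card : ℝ) - 2) * ∑ i ∈ P, ∑ j ∈ P, w i j := by
      rw [Finset.sum_congr rfl herase, Finset.sum_sub_distrib, Finset.sum_sub_distrib,
        Finset.sum_const, nsmul_eq_mul, Finset.sum_comm (f := fun k i => w i k)]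
      ring
    have hPc : (P.card : ℝ) = s + m + 1 := by rw [hP]; push_cast; ring
    have hs' : (2 : ℝ) ≤ s := by exact_mod_cast hs
    have hm : (0 : ℝ) ≤ m := m.cast_nonneg
    obtain ⟨k, hk, hkc⟩ := Finset.exists_le_of_sum_le (s := P)
      (f := fun _ => c * ((s + m : ℝ) * (s + m - 1)))
      (g := fun k => ∑ i ∈ P.erase k, ∑ j ∈ P.erase k, w i j)
      (Finset.card_pos.1 (by omega)) (by
        rw [hsum, Finset.sum_const, nsmul_eq_mul]
        rw [hPc] at h ⊢
        have := mul_le_mul_of_nonneg_left h (by linarith : (0 : ℝ) ≤ s + m + 1 - 2)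
        refine le_trans (le_of_eq ?_) this
        ring)
    have hPk : (P.erase k).card = s + m := by rw [Finset.card_erase_of_mem hk]; omega
    obtain ⟨Q, hQ, hQs⟩ := ih (P.erase k) hPk (by rw [hPk]; push_cast; exact hkc)
    exact ⟨Q, hQ.trans (Finset.erase_subset _ _), hQs⟩

variable {α : Type*} [DecidableEq α]

/-- The ordered pairs from `V` forming an edge with `v`. -/
def linkPairs (H : Finset (Finset α)) (V : Finset α) (v : α) : Finset (α × α) :=
  (V ×ˢ V).filter fun p => {v, p.1, p.2} ∈ H

lemma linkPairs_ne {H : Finset (Finset α)} (h3 : ∀ e ∈ H, e.card = 3) {v a b : α}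
    (h : {v, a, b} ∈ H) : a ≠ b := by
  rintro rfl
  have := h3 _ h
  have h2 := Finset.card_le_two (a := v) (b := a)
  simp only [Finset.mem_singleton, Finset.insert_eq_of_mem] at this
  omega

/-- Many vertices with a dense link on a small set of vertices yield a large matching using
these vertices. -/
lemma exists_tileable_of_dense_links {H : Finset (Finset α)} (h3 : ∀ e ∈ H, e.card = 3)
    {W X : Finset α} {s : ℕ} (hW : W.card = 3 * s) (hWX : Disjoint W X)
    (hdense : ∀ v ∈ X, 5 * s ^ 2 + 4 * s < (linkPairs H W v).card)
    (hX : 2 ^ (9 * s ^ 2) * s < X.card) :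
    ∃ T ⊆ W ∪ X, Tileable (H : Set (Finset α)) T ∧ T.card = 3 * (s + 1) := by
  obtain ⟨y, -, hy⟩ := Finset.exists_lt_card_fiber_of_mul_lt_card_of_maps_to
    (s := X) (t := (W ×ˢ W).powerset) (f := linkPairs H W) (n := s)
    (fun v _ => Finset.mem_powerset.2 (Finset.filter_subset _ _)) (by
      rw [Finset.card_powerset, Finset.card_product, hW]
      convert hX using 3
      ring)
  obtain ⟨Z, hZ, hZc⟩ := Finset.exists_subset_card_eq (n := s + 1) hy
  obtain ⟨v, hv⟩ := Finset.card_pos.1 (by omega : 0 < Z.card)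
  have hZX : Z ⊆ X := hZ.trans (Finset.filter_subset _ _)
  let adj : α → α → Prop := fun a b => (a, b) ∈ y
  have hZy : ∀ z ∈ Z, linkPairs H W z = y := fun z hz => (Finset.mem_filter.1 (hZ hz)).2
  have hadj : ∀ z ∈ Z, ∀ a b, adj a b ↔ (a ∈ W ∧ b ∈ W) ∧ {z, a, b} ∈ H := by
    intro z hz a b
    simp only [adj, ← hZy z hz, linkPairs, Finset.mem_filter, Finset.mem_product]
  have hcard : ((W ×ˢ W).filter fun p => adj p.1 p.2).card = y.card := by
    congr 1
    ext p
    simp only [Finset.mem_filter, adj, Prod.mk.eta, and_iff_right_iff_imp]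
    rw [← hZy v hv]
    exact fun h => (Finset.mem_filter.1 h).1
  have hsymm : ∀ a b, adj a b → adj b a := by
    intro a b h
    rw [hadj v hv] at h ⊢
    refine ⟨h.1.symm, ?_⟩
    rw [Finset.pair_comm]
    exact h.2
  have hirr : ∀ a, ¬ adj a a := fun a h =>
    linkPairs_ne h3 ((hadj v hv a a).1 h).2 rfl
  obtain ⟨S, hSW, ⟨M, hM⟩, hS⟩ : ∃ S ⊆ W, Tileable (pairEdges adj) S ∧ 2 * s < S.card := by
    by_contra! hcon
    have h1 : y.card ≤ 5 * s ^ 2 + 4 * s := by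
      rw [← hcard]
      convert card_adj_le_of_matching_le hsymm hirr hW hcon
    have h2 := hdense v (hZX hv)
    rw [hZy v hv] at h2
    omega
  have hc2 : ∀ e ∈ pairEdges adj, e.card = 2 := by
    rintro e ⟨a, b, hab, rfl⟩
    exact Finset.card_pair (fun h => hirr a (by rwa [← h] at hab))
  have hMc := hM.card_eq hc2
  obtain ⟨N, hNM, hN⟩ := Finset.exists_subset_card_eq (by omega : s + 1 ≤ M.card)
  have hNt := hM.mono hNM
  have hNW : N.biUnion id ⊆ W := by
    refine subset_trans ?_ hSW
    rw [← hM.2.2]; exact Finset.biUnion_subset_biUnion_of_subset_left _ hNM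
  have hdis : Disjoint Z (N.biUnion id) := (hWX.mono hNW hZX).symm
  refine ⟨N.biUnion id ∪ Z, Finset.union_subset_union hNW hZX, ?_, ?_⟩
  · refine tileable_of_insert (G := pairEdges adj) (Y := Z) ?_ N Z hNt subset_rfl hdis
      (by omega)
    rintro z hz e ⟨a, b, hab, rfl⟩
    exact_mod_cast ((hadj z hz a b).1 hab).2
  · rw [Finset.card_union_of_disjoint hdis.symm, hNt.card_eq hc2, hN, hZc]
    ring

lemma card_linkPairs (H : Finset (Finset α)) (V : Finset α) (v : α) :
    ((linkPairs H V v).card : ℝ) = ∑ a ∈ V, ∑ b ∈ V, if {v, a, b} ∈ H then 1 else 0 := by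
  rw [linkPairs, Finset.card_filter, Finset.sum_product]
  push_cast
  rfl

lemma exists_dense_sample {γ : ℝ} (hγ : 0 < γ) {H P : Finset (Finset α)} {V X : Finset α}
    {s : ℕ} (hs : 9 / γ + 2 ≤ s) (hP : IsTiling {e | e.card = 3} P V) (hPs : s ≤ P.card)
    (hdeg : ∀ v ∈ X, (5 / 9 + γ) * (V.card : ℝ) ^ 2 ≤ (linkPairs H V v).card) :
    ∃ Q ⊆ P, Q.card = s ∧ γ * X.card ≤
      9 * (X.filter fun v => 5 * s ^ 2 + 4 * s < (linkPairs H (Q.biUnion id) v).card).card := by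
  have hγs : 9 + 2 * γ ≤ γ * s := by
    have := mul_le_mul_of_nonneg_left hs hγ.le
    rwa [mul_add, mul_div_cancel₀ _ hγ.ne', mul_comm γ 2] at this
  have hV : (V.card : ℝ) = 3 * P.card := by
    exact_mod_cast hP.card_eq (fun e he => he)
  have hs2 : (2 : ℝ) ≤ s := by
    have : 0 ≤ 9 / γ := by positivity
    linarith
  have hPs' : (s : ℝ) ≤ P.card := by exact_mod_cast hPs
  have hX0 : (0 : ℝ) ≤ X.card := X.card.cast_nonneg
  let B : α → α → α → ℝ := fun v a b => if {v, a, b} ∈ H then 1 else 0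
  have hB0 : ∀ v a b, 0 ≤ B v a b := fun v a b => by simp only [B]; split_ifs <;> simp
  have hB1 : ∀ v a b, B v a b ≤ 1 := fun v a b => by simp only [B]; split_ifs <;> simp
  let q : α → Finset α → Finset α → ℝ := fun v E E' => ∑ a ∈ E, ∑ b ∈ E', B v a b
  have hq0 : ∀ v E E', 0 ≤ q v E E' := fun v E E' =>
    Finset.sum_nonneg fun a _ => Finset.sum_nonneg fun b _ => hB0 v a b
  have hq9 : ∀ v, ∀ E ∈ P, q v E E ≤ 9 := by
    intro v E hE
    have hEc : E.card = 3 := hP.1 E hE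
    calc q v E E ≤ ∑ a ∈ E, ∑ b ∈ E, (1 : ℝ) :=
          Finset.sum_le_sum fun a _ => Finset.sum_le_sum fun b _ => hB1 v a b
      _ = 9 := by simp [hEc]; norm_num
  have hqsum : ∀ v, ∀ Q ⊆ P, ((linkPairs H (Q.biUnion id) v).card : ℝ) =
      ∑ E ∈ Q, ∑ E' ∈ Q, q v E E' := by
    intro v Q hQ
    rw [card_linkPairs, (hP.mono hQ).sum_eq]
    refine Finset.sum_congr rfl fun E _ => ?_
    rw [Finset.sum_comm, (hP.mono hQ).sum_eq]
    exact Finset.sum_congr rfl fun E' _ => Finset.sum_comm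
  let w : Finset α → Finset α → ℝ := fun E E' => if E = E' then 0 else ∑ v ∈ X, q v E E'
  have hwP : (5 + 8 * γ) * X.card * (P.card * (P.card - 1)) ≤ ∑ E ∈ P, ∑ E' ∈ P, w E E' := by
    have h1 : ∑ v ∈ X, ∑ E ∈ P, ∑ E' ∈ P, q v E E' ≤
        ∑ E ∈ P, ∑ E' ∈ P, w E E' + X.card * (9 * P.card) := by
      have h2 : ∀ E ∈ P, ∀ E' ∈ P, ∑ v ∈ X, q v E E' ≤
          w E E' + if E = E' then (X.card : ℝ) * 9 else 0 := by
        intro E hE E' hE'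
        simp only [w]
        split_ifs with h
        · subst h
          rw [zero_add, ← nsmul_eq_mul]
          exact Finset.sum_le_card_nsmul _ _ _ fun v _ => hq9 v E hE
        · simp
      simp only [Finset.sum_comm (s := X)]
      refine (Finset.sum_le_sum fun E hE => Finset.sum_le_sum (h2 E hE)).trans (le_of_eq ?_)
      simp only [Finset.sum_add_distrib, Finset.sum_ite_eq]
      rw [Finset.sum_ite_mem, Finset.inter_self, Finset.sum_const, nsmul_eq_mul]
      ring
    have h3 : X.card * ((5 / 9 + γ) * (V.card : ℝ) ^ 2) ≤
        ∑ v ∈ X, ∑ E ∈ P, ∑ E' ∈ P, q v E E' := by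
      rw [← nsmul_eq_mul]
      refine Finset.card_nsmul_le_sum _ _ _ fun v hv => ?_
      rw [← hqsum v P subset_rfl, hP.2.2]
      exact hdeg v hv
    have h4 : (5 + 8 * γ) * (P.card * (P.card - 1)) ≤
        (5 / 9 + γ) * (V.card : ℝ) ^ 2 - 9 * P.card := by
      rw [hV]
      have : 9 ≤ γ * P.card := by nlinarith
      nlinarith
    nlinarith [mul_le_mul_of_nonneg_left h4 hX0]
  obtain ⟨Q, hQP, hQ, hQw⟩ := exists_subset_sum_ge (w := w) (fun E => if_pos rfl)
    (s := s) (by exact_mod_cast hs2) (P.card - s) P (by omega) hwP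
  refine ⟨Q, hQP, hQ, ?_⟩
  set X₀ := X.filter fun v => 5 * s ^ 2 + 4 * s < (linkPairs H (Q.biUnion id) v).card
  have hQ3 : (Q.biUnion id).card = 3 * s := by
    rw [(hP.mono hQP).card_eq (fun e he => he), hQ]
  have h5 : ∑ E ∈ Q, ∑ E' ∈ Q, w E E' ≤
      ∑ v ∈ X, ((linkPairs H (Q.biUnion id) v).card : ℝ) := by
    rw [Finset.sum_congr rfl fun v _ => hqsum v Q hQP]
    simp only [Finset.sum_comm (s := X)]
    refine Finset.sum_le_sum fun E _ => Finset.sum_le_sum fun E' _ => ?_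
    simp only [w]
    split_ifs
    · exact Finset.sum_nonneg fun v _ => hq0 v E E'
    · exact le_rfl
  have h6 : ∑ v ∈ X, ((linkPairs H (Q.biUnion id) v).card : ℝ) ≤
      X.card * (5 * s ^ 2 + 4 * s) + X₀.card * (9 * s ^ 2) := by
    have : ∀ v ∈ X, ((linkPairs H (Q.biUnion id) v).card : ℝ) ≤ (5 * s ^ 2 + 4 * s) +
        if 5 * s ^ 2 + 4 * s < (linkPairs H (Q.biUnion id) v).card then 9 * (s : ℝ) ^ 2
        else 0 := by
      intro v _
      split_ifs with h
      · have h7 : (linkPairs H (Q.biUnion id) v).card ≤ 9 * s ^ 2 := by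
          refine (Finset.card_filter_le _ _).trans (le_of_eq ?_)
          rw [Finset.card_product, hQ3]; ring
        have h8 : ((linkPairs H (Q.biUnion id) v).card : ℝ) ≤ 9 * s ^ 2 := by
          exact_mod_cast h7
        have : (0 : ℝ) ≤ 5 * s ^ 2 + 4 * s := by positivity
        linarith
      · rw [add_zero]
        exact_mod_cast not_lt.1 h
    refine (Finset.sum_le_sum this).trans (le_of_eq ?_)
    rw [Finset.sum_add_distrib, Finset.sum_const, nsmul_eq_mul, ← Finset.sum_filter,
      Finset.sum_const, nsmul_eq_mul]
  have h9 : γ * (s : ℝ) ^ 2 + (5 * s ^ 2 + 4 * s) ≤ (5 + 8 * γ) * (s * (s - 1)) := by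
    nlinarith
  have h10 : (X.card : ℝ) * (γ * s ^ 2) ≤ X₀.card * (9 * s ^ 2) := by
    have := mul_le_mul_of_nonneg_left h9 hX0
    linarith
  have h11 : (0 : ℝ) < s ^ 2 := by positivity
  exact le_of_mul_le_mul_right (by linarith) h11

/-- A dense `3`-graph has a matching missing only a bounded number of vertices. -/
theorem exists_tileable_card_sdiff_le {γ : ℝ} (hγ : 0 < γ) :
    ∃ K : ℕ, ∀ {β : Type*} [DecidableEq β] (H : Finset (Finset β)) (V : Finset β),
      (∀ e ∈ H, e.card = 3) → 3 ∣ V.card →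
      (∀ v ∈ V, (5 / 9 + γ) * (V.card : ℝ) ^ 2 ≤ (linkPairs H V v).card) →
      ∃ S ⊆ V, Tileable (H : Set (Finset β)) S ∧ (V \ S).card ≤ K := by
  obtain ⟨s, hs⟩ := exists_nat_ge (9 / γ + 2)
  obtain ⟨K, hK⟩ := exists_nat_ge (9 * ((2 ^ (9 * s ^ 2) * s + 3 * s + 1 : ℕ) : ℝ) / γ)
  refine ⟨K + 3 * s, fun {β} _ H V h3 hV hdeg => ?_⟩
  obtain ⟨S, hS, hmax⟩ := Finset.exists_max_image
    (V.powerset.filter fun S => Tileable (H : Set (Finset β)) S) Finset.card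
    ⟨∅, by simp [tileable_empty]⟩
  simp only [Finset.mem_filter, Finset.mem_powerset] at hS hmax
  obtain ⟨hSV, M, hM⟩ := hS
  refine ⟨S, hSV, ⟨M, hM⟩, ?_⟩
  by_contra! hcon
  have hSc := hM.card_eq h3
  have hXc := Finset.card_sdiff_add_card_eq_card hSV
  set X := V \ S with hX
  have hSX : Disjoint S X := Finset.disjoint_sdiff
  obtain ⟨N, hN⟩ := tileable_of_card_eq (r := 3) (X.card / 3) X (by omega)
  have hP : IsTiling {e | e.card = 3} (M ∪ N) V := by
    refine ⟨?_, ?_, ?_⟩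
    · intro e he
      rcases Finset.mem_union.1 he with he | he
      exacts [h3 e (hM.1 e he), hN.1 e he]
    · rw [Finset.coe_union, Set.pairwiseDisjoint_union]
      exact ⟨hM.2.1, hN.2.1, fun e he f hf _ =>
        hSX.mono (hM.subset_of_mem he) (hN.subset_of_mem hf)⟩
    · rw [Finset.union_biUnion, hM.2.2, hN.2.2, hX, Finset.union_sdiff_of_subset hSV]
  have hPc := hP.card_eq (fun e he => he)
  obtain ⟨Q, hQP, hQ, hQX⟩ := exists_dense_sample hγ hs hP (by omega)
    (fun v hv => hdeg v ((Finset.sdiff_subset : X ⊆ V) hv))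
  have hQ3 : (Q.biUnion id).card = 3 * s := by
    rw [(hP.mono hQP).card_eq (fun e he => he), hQ]
  set X₀ := X.filter fun v => 5 * s ^ 2 + 4 * s < (linkPairs H (Q.biUnion id) v).card with hX₀
  have hX₀c : 2 ^ (9 * s ^ 2) * s + 3 * s + 1 ≤ X₀.card := by
    rw [div_le_iff₀ hγ] at hK
    have h1 : (K : ℝ) ≤ X.card := by exact_mod_cast (by omega : K ≤ X.card)
    have h2 := mul_le_mul_of_nonneg_right h1 hγ.le
    have : ((2 ^ (9 * s ^ 2) * s + 3 * s + 1 : ℕ) : ℝ) ≤ X₀.card := by linarith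
    exact_mod_cast this
  obtain ⟨T, hT, hTt, hTc⟩ := exists_tileable_of_dense_links h3 hQ3
    (X := X₀ \ Q.biUnion id) (s := s) Finset.disjoint_sdiff
    (fun v hv => (Finset.mem_filter.1 (Finset.mem_sdiff.1 hv).1).2) (by
      have := Finset.le_card_sdiff (Q.biUnion id) X₀
      omega)
  have hQV : Q.biUnion id ⊆ V := by
    rw [← hP.2.2]; exact Finset.biUnion_subset_biUnion_of_subset_left _ hQP
  have hX₀X : X₀ ⊆ X := Finset.filter_subset _ _
  have hMQ := hM.mono (Finset.sdiff_subset : M \ Q ⊆ M)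
  have hMQS : (M \ Q).biUnion id ⊆ S := by
    rw [← hM.2.2]; exact Finset.biUnion_subset_biUnion_of_subset_left _ Finset.sdiff_subset
  have hdQ : Disjoint ((M \ Q).biUnion id) (Q.biUnion id) := by
    have : (M \ Q).biUnion id ⊆ V \ Q.biUnion id := by
      rw [← hP.biUnion_sdiff hQP]
      exact Finset.biUnion_subset_biUnion_of_subset_left _
        (Finset.sdiff_subset_sdiff Finset.subset_union_left subset_rfl)
    exact Finset.sdiff_disjoint.mono_left this
  have hd : Disjoint ((M \ Q).biUnion id) T := by
    refine Disjoint.mono_right hT ?_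
    rw [Finset.disjoint_union_right]
    exact ⟨hdQ, hSX.mono hMQS (Finset.sdiff_subset.trans hX₀X)⟩
  have hfin := hmax ((M \ Q).biUnion id ∪ T)
    ⟨Finset.union_subset (hMQS.trans hSV) (hT.trans (Finset.union_subset hQV
      ((Finset.sdiff_subset.trans hX₀X).trans Finset.sdiff_subset))),
      Tileable.union ⟨_, hMQ⟩ hTt hd⟩
  rw [Finset.card_union_of_disjoint hd, hMQ.card_eq h3, hTc] at hfin
  have := Finset.le_card_sdiff Q M
  omega

end AlmostPerfect

section Absorbing

/-- If every `t ∈ R` is related to at least a proportion `c` of all `b`, then some `b` is related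
to at least a proportion `c` of `R`. -/
lemma exists_popular {τ β : Type*} [Fintype β] [Nonempty β] {R : Finset τ}
    (r : τ → Finset β) {c : ℝ}
    (h : ∀ t ∈ R, c * Fintype.card β ≤ (r t).card) :
    ∃ b, ∃ R' : Finset τ, (∀ t ∈ R', t ∈ R ∧ b ∈ r t) ∧ c * R.card ≤ R'.card := by
  have hsum : ∑ t ∈ R, ((r t).card : ℝ) = ∑ b, ((R.filter fun t => b ∈ r t).card : ℝ) := by
    simp only [Finset.card_filter, Nat.cast_sum]
    rw [Finset.sum_comm]
    refine Finset.sum_congr rfl fun t _ => ?_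
    simp
  have hle := Finset.sum_le_sum h
  rw [hsum, Finset.sum_const, nsmul_eq_mul] at hle
  obtain ⟨b, -, hb⟩ := Finset.exists_le_of_sum_le (s := (Finset.univ : Finset β))
    (f := fun _ => c * R.card)
    (g := fun b => ((R.filter fun t => b ∈ r t).card : ℝ)) Finset.univ_nonempty (by
      rw [Finset.sum_const, nsmul_eq_mul, Finset.card_univ]
      exact le_trans (le_of_eq (by ring)) hle)
  exact ⟨b, R.filter fun t => b ∈ r t, fun t ht => Finset.mem_filter.1 ht, hb⟩

variable {α : Type*} [DecidableEq α]

/-- Whenever `x, y, z` are distinct vertices outside `S`, the set `S ∪ {x, y, z}` is tileable. -/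
def AbsorbsTriple (F : Set (Finset α)) (S : Finset α) (t : α × α × α) : Prop :=
  t.1 ≠ t.2.1 → t.1 ≠ t.2.2 → t.2.1 ≠ t.2.2 → Disjoint S {t.1, t.2.1, t.2.2} →
    Tileable F (S ∪ {t.1, t.2.1, t.2.2})

lemma absorbsTriple_of_mem {F : Set (Finset α)} {u b c u' b' c' : α}
    (hnd : [u, b, c, u', b', c'].Nodup) {t : α × α × α} (h₁ : {t.1, u, u'} ∈ F)
    (h₂ : {t.2.1, b, c} ∈ F) (h₃ : {t.2.2, b', c'} ∈ F) :
    AbsorbsTriple F ({u, b, c} ∪ {u', b', c'}) t := by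
  obtain ⟨x, y, z⟩ := t
  intro h12 h13 h23 hdt
  simp only [List.nodup_cons, List.mem_cons, List.not_mem_nil, or_false, not_or,
    Finset.disjoint_union_left, Finset.disjoint_insert_left,
    Finset.disjoint_singleton_left, Finset.mem_insert, Finset.mem_singleton] at *
  have e1 : Disjoint ({x, u, u'} : Finset α) {y, b, c} := by
    simp only [Finset.disjoint_insert_left, Finset.disjoint_singleton_left, Finset.mem_insert,
      Finset.mem_singleton]
    grind
  have e2 : Disjoint ({x, u, u'} ∪ {y, b, c} : Finset α) {z, b', c'} := by
    simp only [Finset.disjoint_union_left, Finset.disjoint_insert_left,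
      Finset.disjoint_singleton_left, Finset.mem_insert, Finset.mem_singleton]
    grind
  have := ((tileable_of_mem h₁).union (tileable_of_mem h₂) e1).union (tileable_of_mem h₃) e2
  convert this using 1
  ext v
  simp only [Finset.mem_union, Finset.mem_insert, Finset.mem_singleton]
  tauto

variable [Fintype α]

lemma card_pairs_meeting_le (U : Finset α) :
    ((Finset.univ : Finset (α × α)).filter fun p => p.1 ∈ U ∨ p.2 ∈ U).card ≤
      2 * (U.card * Fintype.card α) := by
  have : ((Finset.univ : Finset (α × α)).filter fun p => p.1 ∈ U ∨ p.2 ∈ U) ⊆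
      U ×ˢ Finset.univ ∪ Finset.univ ×ˢ U := by
    intro p hp
    simpa using hp
  refine (Finset.card_le_card this).trans ((Finset.card_union_le _ _).trans (le_of_eq ?_))
  rw [Finset.card_product, Finset.card_product, Finset.card_univ]
  ring

/-- Removing the pairs that meet `U`. -/
lemma card_sub_le_card_filter (L : Finset (α × α)) (U : Finset α) :
    (L.card : ℝ) - 2 * (U.card * Fintype.card α) ≤
      (L.filter fun p => p.1 ∉ U ∧ p.2 ∉ U).card := by
  have h1 := Finset.card_filter_add_card_filter_not (s := L) (fun p => p.1 ∈ U ∨ p.2 ∈ U)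
  have h2 : (L.filter fun p => p.1 ∈ U ∨ p.2 ∈ U).card ≤ 2 * (U.card * Fintype.card α) :=
    (Finset.card_le_card (Finset.filter_subset_filter _ (Finset.subset_univ L))).trans
      (card_pairs_meeting_le U)
  simp only [not_or] at h1
  have h3 : L.card ≤ 2 * (U.card * Fintype.card α) +
    (L.filter fun p => p.1 ∉ U ∧ p.2 ∉ U).card := by omega
  have h4 : (L.card : ℝ) ≤ 2 * (U.card * Fintype.card α) +
    (L.filter fun p => p.1 ∉ U ∧ p.2 ∉ U).card := by exact_mod_cast h3
  linarith

variable {H : Finset (Finset α)}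

lemma absorb_step (h3 : ∀ e ∈ H, e.card = 3)
    (hdeg : ∀ v, 11 / 20 * (Fintype.card α : ℝ) ^ 2 ≤ (linkPairs H univ v).card)
    (hn : 400 ≤ Fintype.card α) {U : Finset α} (hU : (U.card : ℝ) ≤ Fintype.card α / 100)
    {R : Finset (α × α × α)} (hR : R.Nonempty) :
    ∃ S, Disjoint S U ∧ S.card ≤ 6 ∧ Tileable (H : Set (Finset α)) S ∧
      1 / 800 * (R.card : ℝ) ≤ (R.filter fun t => AbsorbsTriple (H : Set (Finset α)) S t).card := by
  have : Nonempty α := ⟨hR.choose.1⟩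
  set n := Fintype.card α with hn'
  have hnR : (400 : ℝ) ≤ n := by exact_mod_cast hn
  have hpair : (Fintype.card (α × α) : ℝ) = (n : ℝ) ^ 2 := by
    rw [Fintype.card_prod, ← hn']; push_cast; ring
  have hmem : ∀ {v a b}, (a, b) ∈ linkPairs H univ v ↔ {v, a, b} ∈ H := by
    simp [linkPairs]
  have havoid : ∀ (L : Finset (α × α)) (U' : Finset α), (U'.card : ℝ) ≤ n / 50 →
      L.card - (n : ℝ) ^ 2 / 25 ≤ (L.filter fun p => p.1 ∉ U' ∧ p.2 ∉ U').card := by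
    intro L U' hU'
    refine le_trans ?_ (card_sub_le_card_filter L U')
    nlinarith
  have hcommon : ∀ x u, (n : ℝ) ^ 2 / 10 ≤
      ((linkPairs H univ x ∩ linkPairs H univ u).card : ℝ) := by
    intro x u
    have h1 := Finset.card_union_add_card_inter (linkPairs H univ x) (linkPairs H univ u)
    have h2 : ((linkPairs H univ x ∪ linkPairs H univ u).card : ℝ) ≤ (n : ℝ) ^ 2 := by
      rw [← hpair]; exact_mod_cast Finset.card_le_univ _
    have h3 : ((linkPairs H univ x ∪ linkPairs H univ u).card : ℝ) +
      (linkPairs H univ x ∩ linkPairs H univ u).card =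
      (linkPairs H univ x).card + (linkPairs H univ u).card := by exact_mod_cast h1
    have := hdeg x
    have := hdeg u
    linarith
  -- the pair completing the first target vertex to an edge
  obtain ⟨⟨u, u'⟩, R₁, hR₁, hu⟩ := exists_popular (R := R)
    (fun t => (linkPairs H univ t.1).filter fun p => p.1 ∉ U ∧ p.2 ∉ U)
    (c := 1 / 2) (fun t _ => by
      have := havoid (linkPairs H univ t.1) U (by linarith)
      have := hdeg t.1
      rw [hpair]
      linarith [sq_nonneg (n : ℝ)])
  -- the pair exchangeable between the second target vertex and `u`
  obtain ⟨⟨b, c⟩, R₂, hR₂, hbc⟩ := exists_popular (R := R₁)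
    (fun t => (linkPairs H univ t.2.1 ∩ linkPairs H univ u).filter
      fun p => p.1 ∉ U ∪ {u, u'} ∧ p.2 ∉ U ∪ {u, u'})
    (c := 1 / 20) (fun t _ => by
      have h1 : ((U ∪ {u, u'}).card : ℝ) ≤ U.card + 2 := by
        exact_mod_cast (Finset.card_union_le _ _).trans
          (Nat.add_le_add_left Finset.card_le_two _)
      have := havoid (linkPairs H univ t.2.1 ∩ linkPairs H univ u) (U ∪ {u, u'}) (by linarith)
      have := hcommon t.2.1 u
      rw [hpair]
      linarith [sq_nonneg (n : ℝ)])
  -- the pair exchangeable between the third target vertex and `u'`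
  obtain ⟨⟨b', c'⟩, R₃, hR₃, hbc'⟩ := exists_popular (R := R₂)
    (fun t => (linkPairs H univ t.2.2 ∩ linkPairs H univ u').filter
      fun p => p.1 ∉ U ∪ {u, u', b, c} ∧ p.2 ∉ U ∪ {u, u', b, c})
    (c := 1 / 20) (fun t _ => by
      have h1 : ((U ∪ {u, u', b, c}).card : ℝ) ≤ U.card + 4 := by
        exact_mod_cast (Finset.card_union_le _ _).trans
          (Nat.add_le_add_left Finset.card_le_four _)
      have := havoid (linkPairs H univ t.2.2 ∩ linkPairs H univ u') (U ∪ {u, u', b, c})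
        (by linarith)
      have := hcommon t.2.2 u'
      rw [hpair]
      linarith [sq_nonneg (n : ℝ)])
  have hR₃' : R₃.Nonempty := by
    rw [← Finset.card_pos]
    have : (0 : ℝ) < R.card := by exact_mod_cast hR.card_pos
    have : (0 : ℝ) < R₃.card := by linarith
    exact_mod_cast this
  have hR₃sub : ∀ t ∈ R₃, t ∈ R ∧ {t.1, u, u'} ∈ H ∧ {t.2.1, b, c} ∈ H ∧
      {t.2.2, b', c'} ∈ H := by
    intro t ht
    obtain ⟨ht₂, h₃⟩ := hR₃ t ht
    obtain ⟨ht₁, h₂⟩ := hR₂ t ht₂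
    obtain ⟨htR, h₁⟩ := hR₁ t ht₁
    simp only [Finset.mem_filter, Finset.mem_inter, hmem] at h₁ h₂ h₃
    exact ⟨htR, h₁.1, h₂.1.1, h₃.1.1⟩
  obtain ⟨t, ht⟩ := hR₃'
  obtain ⟨ht₂, h₃⟩ := hR₃ t ht
  obtain ⟨ht₁, h₂⟩ := hR₂ t ht₂
  obtain ⟨-, h₁⟩ := hR₁ t ht₁
  simp only [Finset.mem_filter, Finset.mem_inter, hmem, Finset.mem_union,
    Finset.mem_insert, Finset.mem_singleton, not_or] at h₁ h₂ h₃
  obtain ⟨hxu, huU, hu'U⟩ := h₁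
  obtain ⟨⟨-, hubc⟩, hbU, hcU⟩ := h₂
  obtain ⟨⟨-, hu'bc⟩, hb'U, hc'U⟩ := h₃
  have huu' : u ≠ u' := linkPairs_ne h3 hxu
  have hbc : b ≠ c := linkPairs_ne h3 hubc
  have hbc' : b' ≠ c' := linkPairs_ne h3 hu'bc
  have hnd : [u, b, c, u', b', c'].Nodup := by
    simp only [List.nodup_cons, List.mem_cons, List.not_mem_nil, or_false, not_or,
      List.nodup_nil, not_false_eq_true, and_true]
    simp only [ne_eq, eq_comm] at *
    tauto
  have hd : Disjoint ({u, b, c} : Finset α) {u', b', c'} := by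
    simp only [List.nodup_cons, List.mem_cons, List.not_mem_nil, or_false, not_or] at hnd
    simp only [Finset.disjoint_insert_left, Finset.disjoint_singleton_left, Finset.mem_insert,
      Finset.mem_singleton]
    tauto
  refine ⟨{u, b, c} ∪ {u', b', c'}, ?_, ?_, ?_, ?_⟩
  · simp only [Finset.disjoint_union_left, Finset.disjoint_insert_left,
      Finset.disjoint_singleton_left]
    tauto
  · exact (Finset.card_union_le _ _).trans
      (Nat.add_le_add Finset.card_le_three Finset.card_le_three)
  · exact (tileable_of_mem (by exact_mod_cast hubc)).union
      (tileable_of_mem (by exact_mod_cast hu'bc)) hd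
  have hle : R₃.card ≤ (R.filter fun t =>
      AbsorbsTriple (H : Set (Finset α)) ({u, b, c} ∪ {u', b', c'}) t).card := by
    refine Finset.card_le_card fun t ht => ?_
    obtain ⟨htR, h₁, h₂, h₃⟩ := hR₃sub t ht
    exact Finset.mem_filter.2 ⟨htR, absorbsTriple_of_mem hnd (by exact_mod_cast h₁)
      (by exact_mod_cast h₂) (by exact_mod_cast h₃)⟩
  have hle' : (R₃.card : ℝ) ≤ (R.filter fun t =>
      AbsorbsTriple (H : Set (Finset α)) ({u, b, c} ∪ {u', b', c'}) t).card := by exact_mod_cast hle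
  linarith

lemma absorb_iterate (h3 : ∀ e ∈ H, e.card = 3)
    (hdeg : ∀ v, 11 / 20 * (Fintype.card α : ℝ) ^ 2 ≤ (linkPairs H univ v).card)
    (hn : 400 ≤ Fintype.card α) {U : Finset α} : ∀ r : ℕ,
    (U.card + 6 * r : ℝ) ≤ Fintype.card α / 100 →
    ∃ S, Disjoint S U ∧ S.card ≤ 6 * r ∧ Tileable (H : Set (Finset α)) S ∧
      ((univ.filter fun t => ¬ AbsorbsTriple (H : Set (Finset α)) S t).card : ℝ) ≤
        (799 / 800) ^ r * (Fintype.card α : ℝ) ^ 3 := by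
  intro r
  induction r with
  | zero =>
    intro _
    refine ⟨∅, by simp, by simp, tileable_empty _, ?_⟩
    have : (univ.filter fun t => ¬ AbsorbsTriple (H : Set (Finset α)) ∅ t).card ≤
        Fintype.card (α × α × α) := Finset.card_le_univ _
    rw [Fintype.card_prod, Fintype.card_prod] at this
    rw [pow_zero, one_mul, pow_three]
    exact_mod_cast this
  | succ r ih =>
    intro hr
    push_cast at hr
    obtain ⟨S, hSU, hSc, hS, hSR⟩ := ih (by linarith)
    set R := univ.filter fun t => ¬ AbsorbsTriple (H : Set (Finset α)) S t with hR
    rcases R.eq_empty_or_nonempty with hR0 | hR0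
    · refine ⟨S, hSU, by omega, hS, ?_⟩
      rw [← hR, hR0, Finset.card_empty, Nat.cast_zero]
      positivity
    obtain ⟨S', hS'U, hS'c, hS', hS'R⟩ := absorb_step h3 hdeg hn (U := U ∪ S) (by
      have h1 : ((U ∪ S).card : ℝ) ≤ U.card + 6 * r := by
        exact_mod_cast (Finset.card_union_le _ _).trans (Nat.add_le_add_left hSc _)
      linarith) hR0
    rw [Finset.disjoint_union_right] at hS'U
    refine ⟨S ∪ S', by rw [Finset.disjoint_union_left]; exact ⟨hSU, hS'U.1⟩,
      (Finset.card_union_le _ _).trans (by omega), hS.union hS' hS'U.2.symm, ?_⟩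
    have hsub : (univ.filter fun t => ¬ AbsorbsTriple (H : Set (Finset α)) (S ∪ S') t) ⊆
        R.filter fun t => ¬ AbsorbsTriple (H : Set (Finset α)) S' t := by
      intro t ht
      simp only [hR, Finset.mem_filter, Finset.mem_univ, true_and] at ht ⊢
      refine ⟨fun hab => ht fun h1 h2 h3 hd => ?_, fun hab => ht fun h1 h2 h3 hd => ?_⟩
      all_goals rw [Finset.disjoint_union_left] at hd
      · have := (hab h1 h2 h3 hd.1).union hS' (by
          rw [Finset.disjoint_union_left]; exact ⟨hS'U.2.symm, hd.2.symm⟩)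
        rwa [Finset.union_right_comm] at this
      · have := hS.union (hab h1 h2 h3 hd.2) (by
          rw [Finset.disjoint_union_right]; exact ⟨hS'U.2.symm, hd.1⟩)
        rwa [← Finset.union_assoc] at this
    have h1 : ((univ.filter fun t => ¬ AbsorbsTriple (H : Set (Finset α)) (S ∪ S') t).card : ℝ) ≤
        (R.filter fun t => ¬ AbsorbsTriple (H : Set (Finset α)) S' t).card := by
      exact_mod_cast Finset.card_le_card hsub
    have h2 : ((R.filter fun t => AbsorbsTriple (H : Set (Finset α)) S' t).card : ℝ) +
        (R.filter fun t => ¬ AbsorbsTriple (H : Set (Finset α)) S' t).card = R.card := by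
      exact_mod_cast Finset.card_filter_add_card_filter_not (s := R) _
    rw [pow_succ']
    linarith

/-- Iterating gives a small set absorbing every set of at most `3 L` further vertices. -/
lemma exists_absorbing_set (h3 : ∀ e ∈ H, e.card = 3)
    (hdeg : ∀ v, 11 / 20 * (Fintype.card α : ℝ) ^ 2 ≤ (linkPairs H univ v).card)
    (hn : 400 ≤ Fintype.card α) {r : ℕ}
    (hr : (799 / 800 : ℝ) ^ r * (Fintype.card α : ℝ) ^ 3 < 1) : ∀ L : ℕ,
    (6 * r * L : ℝ) ≤ Fintype.card α / 100 →
    ∃ S : Finset α, S.card ≤ 6 * r * L ∧ Tileable (H : Set (Finset α)) S ∧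
      ∀ X, Disjoint S X → ∀ j ≤ L, X.card = 3 * j → Tileable (H : Set (Finset α)) (S ∪ X) := by
  intro L
  induction L with
  | zero =>
    intro _
    refine ⟨∅, by simp, tileable_empty _, fun X _ j hj hX => ?_⟩
    obtain rfl : X = ∅ := Finset.card_eq_zero.1 (by omega)
    simpa using tileable_empty _
  | succ L ih =>
    intro hL
    push_cast at hL
    have h6r : (0 : ℝ) ≤ 6 * r := by positivity
    obtain ⟨S, hSc, hS, hSX⟩ := ih (by linarith)
    obtain ⟨S', hS'U, hS'c, hS', hS'R⟩ := absorb_iterate h3 hdeg hn (U := S) r (by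
      have h1 : (S.card : ℝ) ≤ 6 * r * L := by exact_mod_cast hSc
      linarith)
    have habs : ∀ t, AbsorbsTriple (H : Set (Finset α)) S' t := by
      have h1 : (univ.filter fun t => ¬ AbsorbsTriple (H : Set (Finset α)) S' t).card < 1 := by
        exact_mod_cast hS'R.trans_lt hr
      rw [Nat.lt_one_iff, Finset.card_eq_zero, Finset.filter_eq_empty_iff] at h1
      exact fun t => not_not.1 (h1 (Finset.mem_univ t))
    have hcard : (S ∪ S').card ≤ 6 * r * (L + 1) :=
      (Finset.card_union_le _ _).trans (by rw [mul_add, mul_one]; omega)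
    refine ⟨S ∪ S', hcard, hS.union hS' hS'U.symm, fun X hX j hj hXc => ?_⟩
    rw [Finset.disjoint_union_left] at hX
    rcases Nat.eq_zero_or_pos j with rfl | hj0
    · obtain rfl : X = ∅ := Finset.card_eq_zero.1 (by omega)
      simpa using hS.union hS' hS'U.symm
    obtain ⟨T, hTX, hT⟩ := Finset.exists_subset_card_eq (by omega : 3 ≤ X.card)
    have h1 := hSX (X \ T) (hX.1.mono_right Finset.sdiff_subset) (j - 1) (by omega)
      (by rw [Finset.card_sdiff_of_subset hTX]; omega)
    obtain ⟨x, y, z, hxy, hxz, hyz, rfl⟩ := Finset.card_eq_three.1 hT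
    have h2 := habs (x, y, z) hxy hxz hyz (hX.2.mono_right hTX)
    have h4 := h1.union h2 (by
      rw [Finset.disjoint_union_left, Finset.disjoint_union_right, Finset.disjoint_union_right]
      exact ⟨⟨hS'U.symm, hX.1.mono_right hTX⟩, (hX.2.mono_right Finset.sdiff_subset).symm,
        Finset.sdiff_disjoint⟩)
    convert h4 using 1
    conv_lhs => rw [← Finset.sdiff_union_of_subset hTX]
    ext v
    simp only [Finset.mem_union]
    tauto

end Absorbing

section Degree

variable {α : Type*} [DecidableEq α] [Fintype α] {H : Finset (Finset α)}

/-- Each edge at `v` gives two ordered pairs in the link of `v`. -/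
lemma two_mul_card_le_card_linkPairs (h3 : ∀ e ∈ H, e.card = 3) (v : α) :
    2 * (H.filter fun e => v ∈ e).card ≤ (linkPairs H univ v).card := by
  have hmem : ∀ {a b}, (a, b) ∈ linkPairs H univ v ↔ {v, a, b} ∈ H := by
    simp [linkPairs]
  refine Finset.mul_card_image_le_card_of_maps_to (f := fun p : α × α => {v, p.1, p.2}) ?_ 2 ?_
  · rintro ⟨a, b⟩ hp
    exact Finset.mem_filter.2 ⟨hmem.1 hp, by simp⟩
  · intro e he
    obtain ⟨heH, hve⟩ := Finset.mem_filter.1 he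
    have h2 : (e.erase v).card = 2 := by rw [Finset.card_erase_of_mem hve, h3 e heH]
    obtain ⟨a, b, hab, heq⟩ := Finset.card_eq_two.1 h2
    have he' : {v, a, b} = e := by rw [← heq, Finset.insert_erase hve]
    have hsub : {(a, b), (b, a)} ⊆
        (linkPairs H univ v).filter fun p => ({v, p.1, p.2} : Finset α) = e := by
      intro p hp
      rcases Finset.mem_insert.1 hp with rfl | hp
      · exact Finset.mem_filter.2 ⟨hmem.2 (by rwa [he']), he'⟩
      · obtain rfl := Finset.mem_singleton.1 hp
        have he'' : {v, b, a} = e := by rw [Finset.pair_comm, he']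
        exact Finset.mem_filter.2 ⟨hmem.2 (by rwa [he'']), he''⟩
    refine le_trans (le_of_eq ?_) (Finset.card_le_card hsub)
    exact (Finset.card_pair fun h => hab (Prod.ext_iff.1 h).1).symm

lemma card_linkPairs_sdiff_ge (S : Finset α) (v : α) :
    ((linkPairs H univ v).card : ℝ) - 2 * (S.card * Fintype.card α) ≤
      (linkPairs H (univ \ S) v).card := by
  refine (card_sub_le_card_filter (linkPairs H univ v) S).trans (le_of_eq ?_)
  congr 2
  ext p
  simp [linkPairs]
  tauto

end Degree

lemma eventually_pow_floor_mul_pow_lt {q : ℝ} (hq : 0 < q) (hq1 : q < 1) {η : ℝ} (hη : 0 < η)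
    (k : ℕ) : ∀ᶠ n : ℕ in Filter.atTop, q ^ ⌊η * n⌋₊ * (n : ℝ) ^ k < 1 := by
  have h1 : |q ^ η| < 1 := by
    rw [abs_of_pos (Real.rpow_pos_of_pos hq η)]
    exact Real.rpow_lt_one hq.le hq1 hη
  filter_upwards [(tendsto_pow_const_mul_const_pow_of_abs_lt_one k h1).eventually_lt_const hq]
    with n hn
  have h2 : q ^ ⌊η * n⌋₊ ≤ (q ^ η) ^ n / q := by
    rw [← Real.rpow_natCast, ← Real.rpow_natCast, ← Real.rpow_mul hq.le, ← Real.rpow_sub_one hq.ne']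
    exact Real.rpow_le_rpow_of_exponent_ge hq hq1.le (Nat.sub_one_lt_floor _).le
  calc q ^ ⌊η * n⌋₊ * (n : ℝ) ^ k ≤ (q ^ η) ^ n / q * (n : ℝ) ^ k := by gcongr
    _ = (n : ℝ) ^ k * (q ^ η) ^ n / q := by ring
    _ < 1 := (div_lt_one hq).2 hn

lemma Tileable.exists_isPerfectMatching {n : ℕ} {H : Finset (Finset (Fin n))}
    (h : Tileable (H : Set (Finset (Fin n))) univ) : ∃ M, IsPerfectMatching H M := by
  obtain ⟨M, hMH, hd, hM⟩ := h
  refine ⟨M, ⟨fun e he => hMH e he, fun e he f hf hef => hd he hf hef⟩, ?_⟩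
  rw [cover, ← hM]

/-- Hàn, Person and Schacht: for all `γ > 0` there is `n₀` such that every `3`-graph on
`n ≥ n₀` vertices, `3 ∣ n`, with minimum vertex degree at least `(5/9 + γ) * C(n,2)`
contains a perfect matching. -/
theorem hps_vertex_degree_threshold (γ : ℝ) (hγ : 0 < γ) :
    ∃ n₀ : ℕ, ∀ n : ℕ, n₀ ≤ n → 3 ∣ n →
      ∀ H : Finset (Finset (Fin n)), Is3Graph n H →
      (∀ v : Fin n, ((5 : ℝ)/9 + γ) * (n.choose 2) ≤ (deg H v : ℝ)) →
      ∃ M, IsPerfectMatching H M := by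
  obtain ⟨K, hK⟩ := exists_tileable_card_sdiff_le (half_pos hγ)
  set c : ℝ := min (1 / 100) (γ / 8) with hc
  have hc0 : 0 < c := by positivity
  have hc1 : c ≤ 1 / 100 := min_le_left _ _
  have hc2 : c ≤ γ / 8 := min_le_right _ _
  set η : ℝ := c / (6 * (K + 1)) with hη
  have hη0 : 0 < η := by positivity
  obtain ⟨n₀, hn₀⟩ := Filter.eventually_atTop.1
    (((eventually_pow_floor_mul_pow_lt (q := 799 / 800) (by norm_num) (by norm_num) hη0 3).and
      (Filter.eventually_ge_atTop 400)).and
      (tendsto_natCast_atTop_atTop.eventually_ge_atTop ((5 / 9 + γ) / (γ / 4))))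
  refine ⟨n₀, fun n hn h3n H h3 hdeg => ?_⟩
  obtain ⟨⟨hq, hn400⟩, hnγ⟩ := hn₀ n hn
  have hn400' : (400 : ℝ) ≤ n := by exact_mod_cast hn400
  rw [div_le_iff₀ (by positivity)] at hnγ
  set r := ⌊η * n⌋₊ with hr
  have hrK : (6 * r * K : ℝ) ≤ c * n := by
    have h1 : (r : ℝ) ≤ η * n := Nat.floor_le (by positivity)
    calc (6 * r * K : ℝ) ≤ 6 * (η * n) * (K + 1) := by gcongr; linarith
      _ = c * n := by rw [hη]; field_simp
  have hlink : ∀ v, (5 / 9 + γ) * ((n : ℝ) * (n - 1)) ≤ (linkPairs H univ v).card := by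
    intro v
    have h1 : (2 * (deg H v : ℝ)) ≤ (linkPairs H univ v).card := by
      have := two_mul_card_le_card_linkPairs h3 v
      rw [deg]
      exact_mod_cast (by convert this)
    have h2 := hdeg v
    rw [Nat.cast_choose_two] at h2
    linarith
  obtain ⟨S, hSc, hSt, hS⟩ := exists_absorbing_set (H := H) (r := r) h3
    (fun v => by
      rw [Fintype.card_fin]
      nlinarith [hlink v, mul_nonneg hγ.le (by nlinarith : (0 : ℝ) ≤ n * (n - 1))])
    (by rwa [Fintype.card_fin]) (by rwa [Fintype.card_fin]) K
    (by rw [Fintype.card_fin]; nlinarith)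
  have hSc' : (S.card : ℝ) ≤ γ / 8 * n := by
    have h1 : (S.card : ℝ) ≤ 6 * r * K := by exact_mod_cast hSc
    nlinarith
  have hS3 : 3 ∣ S.card := by
    obtain ⟨M, hM⟩ := hSt
    exact Dvd.intro _ (hM.card_eq h3).symm
  have hVc : (univ \ S).card + S.card = n := by
    rw [Finset.card_sdiff_add_card_eq_card (subset_univ S), Finset.card_univ, Fintype.card_fin]
  obtain ⟨T, hTV, hT, hTc⟩ := hK H (univ \ S) h3 (by omega) (by
    intro v _
    have h1 := card_linkPairs_sdiff_ge (H := H) S v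
    rw [Fintype.card_fin] at h1
    have h2 : ((univ \ S).card : ℝ) ≤ n := by exact_mod_cast (by omega)
    have h3 : (((univ \ S).card : ℝ)) ^ 2 ≤ (n : ℝ) ^ 2 := by gcongr
    have h4 : (5 / 9 + γ / 2) * (((univ \ S).card : ℝ)) ^ 2 ≤ (5 / 9 + γ / 2) * (n : ℝ) ^ 2 := by
      gcongr
    nlinarith [hlink v])
  set X := (univ \ S) \ T with hX
  have hXc : X.card + T.card = (univ \ S).card := Finset.card_sdiff_add_card_eq_card hTV
  have hT3 : 3 ∣ T.card := by
    obtain ⟨M, hM⟩ := hT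
    exact Dvd.intro _ (hM.card_eq h3).symm
  have hSX : Disjoint S X := Finset.disjoint_sdiff.mono_right Finset.sdiff_subset
  refine Tileable.exists_isPerfectMatching ?_
  have hdT : Disjoint (S ∪ X) T := Finset.disjoint_union_left.2
    ⟨Finset.disjoint_sdiff.mono_right hTV, Finset.sdiff_disjoint⟩
  have huniv := (hS X hSX (X.card / 3) (by omega) (by omega)).union hT hdT
  rwa [Finset.union_assoc, Finset.sdiff_union_of_subset hTV,
    Finset.union_sdiff_of_subset (subset_univ S)] at huniv
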